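/- (Local a posteriori error bound in the conserved quantities.) Under the stated hypotheses (no Lipschitz assumption required), the error in the conserved quantities satisfies ‖C̄ e^n‖ ≤ Σ_{ℓ=0}^k ( |β_ℓ| Δt / |α_0| ) ‖ C̄ f(x_0 + x^{n−ℓ}, t^{n−ℓ}) − C̄ f(x_0 + Φ x̂^{n−ℓ}, t^{n−ℓ}) ‖ + Σ_{ℓ=1}^k ( |α_ℓ| / |α_0| ) ‖C̄ e^{n−ℓ}‖. In particular, the new contribution to the error at time instance n arises only from the error in the C̄-projected velocity (i.e., the flux and source terms over the subdomains) evaluated at the reduced solution. -/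

import Mathlib

open Matrix Finset

noncomputable def euclNorm {n : ℕ} (v : Fin n → ℝ) : ℝ := Real.sqrt (∑ i, v i ^ 2)

theorem euclNorm_eq_norm {n : ℕ} (v : Fin n → ℝ) : euclNorm v = ‖WithLp.toLp 2 v‖ := by
  simp [euclNorm, EuclideanSpace.norm_eq]

theorem norm_le_of_smul_eq_sum_sub_sum {E ι κ : Type*} [NormedAddCommGroup E] [NormedSpace ℝ E]
    {a : ℝ} (ha : a ≠ 0) {s : Finset ι} {t : Finset κ} {b : ι → ℝ} {c : κ → ℝ}
    {u : E} {v : ι → E} {w : κ → E}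
    (h : a • u = ∑ i ∈ s, b i • v i - ∑ j ∈ t, c j • w j) :
    ‖u‖ ≤ ∑ i ∈ s, |b i| / |a| * ‖v i‖ + ∑ j ∈ t, |c j| / |a| * ‖w j‖ := by
  have ha' : 0 < |a| := abs_pos.mpr ha
  have key : |a| * ‖u‖ ≤ ∑ i ∈ s, |b i| * ‖v i‖ + ∑ j ∈ t, |c j| * ‖w j‖ := by
    rw [← Real.norm_eq_abs, ← norm_smul, h]
    refine (norm_sub_le _ _).trans (add_le_add ?_ ?_) <;>
    · refine (norm_sum_le _ _).trans_eq (Finset.sum_congr rfl fun _ _ => ?_)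
      rw [norm_smul, Real.norm_eq_abs]
  simp_rw [div_mul_eq_mul_div, ← Finset.sum_div, ← add_div]
  rwa [le_div_iff₀ ha', mul_comm]

/-- Local a posteriori error bound in the conserved quantities (no Lipschitz
assumption required). -/
theorem conserved_quantities_error_bound
    (N Nb p k : ℕ) (hN : 0 < N) (hNb : 0 < Nb) (hp : 0 < p) (hk : 1 ≤ k)
    (Φ : Matrix (Fin N) (Fin p) ℝ) (hΦ : Φᵀ * Φ = 1)
    (C : Matrix (Fin Nb) (Fin N) ℝ)
    (Δt : ℝ) (hΔt : 0 < Δt)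
    (α β : ℕ → ℝ) (hα0 : α 0 ≠ 0)
    (t : ℕ → ℝ) (x0 : Fin N → ℝ)
    (f : (Fin N → ℝ) → ℝ → (Fin N → ℝ))
    (rhat : (ℕ → Fin N → ℝ) → (Fin N → ℝ))
    (hrhat : ∀ y, rhat y = ∑ ℓ ∈ Finset.Icc 1 k,
      ((β ℓ * Δt) • f (x0 + y ℓ) (t ℓ) - α ℓ • y ℓ))
    (x : ℕ → Fin N → ℝ)
    (hFOM : α 0 • x 0 = (β 0 * Δt) • f (x0 + x 0) (t 0) + rhat x)
    (xh : ℕ → Fin p → ℝ)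
    (hcons : α 0 • (C * Φ).mulVec (xh 0)
      = (β 0 * Δt) • C.mulVec (f (x0 + Φ.mulVec (xh 0)) (t 0))
        + C.mulVec (rhat (fun ℓ => Φ.mulVec (xh ℓ))))
    (e : ℕ → Fin N → ℝ) (he : ∀ m, e m = x m - Φ.mulVec (xh m)) :
    euclNorm (C.mulVec (e 0)) ≤
      (∑ ℓ ∈ Finset.range (k + 1), (|β ℓ| * Δt / |α 0|) *
        euclNorm (C.mulVec (f (x0 + x ℓ) (t ℓ))
          - C.mulVec (f (x0 + Φ.mulVec (xh ℓ)) (t ℓ))))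
      + ∑ ℓ ∈ Finset.Icc 1 k, (|α ℓ| / |α 0|) * euclNorm (C.mulVec (e ℓ)) := by
  have h : α 0 • C.mulVec (e 0) =
      ∑ ℓ ∈ Finset.range (k + 1), (β ℓ * Δt) •
        (C.mulVec (f (x0 + x ℓ) (t ℓ)) - C.mulVec (f (x0 + Φ.mulVec (xh ℓ)) (t ℓ)))
      - ∑ ℓ ∈ Finset.Icc 1 k, α ℓ • C.mulVec (e ℓ) := by
    have hsplit : ∀ g : ℕ → Fin Nb → ℝ,
        ∑ ℓ ∈ Finset.range (k + 1), g ℓ = g 0 + ∑ ℓ ∈ Finset.Icc 1 k, g ℓ := fun g => by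
      rw [Finset.range_eq_Ico, Finset.sum_eq_sum_Ico_succ_bot k.succ_pos]
      rfl
    have hC := congrArg C.mulVec hFOM
    rw [hrhat] at hC hcons
    rw [hsplit, he 0, Matrix.mulVec_sub, smul_sub, Matrix.mulVec_mulVec, hcons,
      ← Matrix.mulVec_smul, hC]
    simp only [he, Matrix.mulVec_add, Matrix.mulVec_sub, Matrix.mulVec_smul, Matrix.mulVec_sum,
      smul_sub, Finset.sum_sub_distrib]
    abel
  have hE := congrArg (WithLp.toLp 2) h
  simp only [WithLp.toLp_smul, WithLp.toLp_sub, WithLp.toLp_sum] at hE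
  simpa only [euclNorm_eq_norm, WithLp.toLp_sub, abs_mul, abs_of_pos hΔt] using
    norm_le_of_smul_eq_sum_sub_sum hα0 hE
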